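/- Let H be a connected reduced bipartite graph with bipartition {X, Y} such that |X| ≤ 7, |Y| ≥ |X|, and every vertex v ∈ Y has degree d_H(v) ≥ 3 in H. Then either H contains a 4-cycle passing through a vertex of X whose degree in H is at least 4, or |Y| = |X| and H is supereulerian. -/

import Mathlib

open scoped Classical

/-- A finite loopless multigraph on vertex type `V`, given by a multiset of edges. -/
structure Multigraph (V : Type) where
  edges : Multiset (Sym2 V)
  loopless : ∀ e ∈ edges, ¬ e.IsDiag

namespace Multigraph

variable {V W : Type}

/-- The degree of a vertex with respect to a multiset of edges. -/
noncomputable def degIn (E : Multiset (Sym2 V)) (v : V) : ℕ :=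
  Multiset.card (E.filter fun e => v ∈ e)

/-- The degree of a vertex in a multigraph. -/
noncomputable def deg (G : Multigraph V) (v : V) : ℕ :=
  degIn G.edges v

/-- All endpoints of the edges in `E` lie in `S`. -/
def Within (S : Set V) (E : Multiset (Sym2 V)) : Prop :=
  ∀ e ∈ E, ∀ v ∈ e, v ∈ S

/-- The graph with vertex set `S` and edge multiset `E` is connected (and spans `S`). -/
def ConnOn (S : Set V) (E : Multiset (Sym2 V)) : Prop :=
  S.Nonempty ∧ Within S E ∧
    ∀ u ∈ S, ∀ v ∈ S, Relation.ReflTransGen (fun a b => s(a, b) ∈ E) u v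

/-- The graph with vertex set `S` and edge multiset `E` is collapsible: for every even subset
`R` of `S` there is a spanning connected subgraph whose set of odd-degree vertices is `R`. -/
def CollapsiblePair (S : Set V) (E : Multiset (Sym2 V)) : Prop :=
  S.Nonempty ∧ Within S E ∧
    ∀ R : Set V, R ⊆ S → R.Finite → Even R.ncard →
      ∃ E' ≤ E, ConnOn S E' ∧ ∀ x ∈ S, (Odd (degIn E' x) ↔ x ∈ R)

/-- `(S, E)` is a subgraph of `G`. -/
def IsSubpair (G : Multigraph V) (S : Set V) (E : Multiset (Sym2 V)) : Prop :=
  E ≤ G.edges ∧ Within S E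

/-- A multigraph is reduced if it has no collapsible subgraph with more than one vertex. -/
def Reduced (G : Multigraph V) : Prop :=
  ∀ S E, G.IsSubpair S E → CollapsiblePair S E → S.ncard ≤ 1

/-- `(S, E)` is a maximal collapsible subgraph of `G`. -/
def MaxCollapsibleSub (G : Multigraph V) (S : Set V) (E : Multiset (Sym2 V)) : Prop :=
  G.IsSubpair S E ∧ CollapsiblePair S E ∧
    ∀ S' E', G.IsSubpair S' E' → CollapsiblePair S' E' → S ⊆ S' → E ≤ E' → S' = S ∧ E' = E

/-- `(S, E)` is a nontrivial maximal collapsible subgraph of `G`. -/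
def NontrivMaxCollapsible (G : Multigraph V) (S : Set V) (E : Multiset (Sym2 V)) : Prop :=
  G.MaxCollapsibleSub S E ∧ 1 < S.ncard

/-- The multiset of edges of `G` with both ends in `S`. -/
noncomputable def inducedEdges (G : Multigraph V) (S : Set V) : Multiset (Sym2 V) :=
  G.edges.filter fun e => ∀ v ∈ e, v ∈ S

/-- `S` is the vertex set of a maximal collapsible subgraph of `G`. -/
def IsMaxCollapsibleSet (G : Multigraph V) (S : Set V) : Prop :=
  CollapsiblePair S (G.inducedEdges S) ∧
    ∀ T : Set V, S ⊆ T → CollapsiblePair T (G.inducedEdges T) → T = S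

/-- `G'` (on vertex type `W`) is the reduction of `G`, witnessed by the contraction map `f`:
the fibres of `f` are exactly the (vertex sets of the) maximal collapsible subgraphs of `G`,
and the edges of `G'` are obtained by contracting each fibre to a point and deleting the
resulting loops. -/
def IsReduction (G : Multigraph V) (f : V → W) (G' : Multigraph W) : Prop :=
  Function.Surjective f ∧ (∀ w : W, G.IsMaxCollapsibleSet (f ⁻¹' {w})) ∧
    G'.edges = (G.edges.map (Sym2.map f)).filter fun e => ¬ e.IsDiag

/-- A multigraph is supereulerian if it has a spanning connected subgraph in which every
vertex has even degree. -/
def Supereulerian (G : Multigraph V) : Prop :=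
  ∃ E' ≤ G.edges, ConnOn Set.univ E' ∧ ∀ x : V, Even (degIn E' x)

/-- A multigraph is connected. -/
def Connected (G : Multigraph V) : Prop :=
  ConnOn Set.univ G.edges

/-- A multigraph is 3-edge-connected (edge connectivity at least 3): removing any at most two
edges leaves a spanning connected graph. -/
def ThreeEdgeConnected (G : Multigraph V) : Prop :=
  ∀ F : Multiset (Sym2 V), F ≤ G.edges → Multiset.card F ≤ 2 →
    ConnOn Set.univ (G.edges - F)

/-- A spanning tree: spanning connected with `|V| - 1` edges. -/
def IsSpanningTree [Fintype V] (E : Multiset (Sym2 V)) : Prop :=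
  ConnOn Set.univ E ∧ Multiset.card E = Fintype.card V - 1

/-- The edge multiset `E` contains two edge-disjoint spanning trees. -/
def HasTwoDisjointSpanningTrees [Fintype V] (E : Multiset (Sym2 V)) : Prop :=
  ∃ T₁ T₂ : Multiset (Sym2 V), T₁ + T₂ ≤ E ∧ IsSpanningTree T₁ ∧ IsSpanningTree T₂

/-- `F(G)`: the minimum number of extra (loopless) edges whose addition to `G` produces a
spanning supergraph having two edge-disjoint spanning trees. -/
noncomputable def FVal [Fintype V] (G : Multigraph V) : ℕ :=
  sInf {k : ℕ | ∃ Eadd : Multiset (Sym2 V), (∀ e ∈ Eadd, ¬ e.IsDiag) ∧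
    Multiset.card Eadd = k ∧ HasTwoDisjointSpanningTrees (G.edges + Eadd)}

/-- `σ̄₂(G)`: the minimum of `deg u + deg v` over edges `uv` of `G`. -/
noncomputable def sigma2bar (G : Multigraph V) : ℕ :=
  sInf {k : ℕ | ∃ u v : V, s(u, v) ∈ G.edges ∧ G.deg u + G.deg v = k}

/-- `G` contains a cycle of length four. -/
def HasFourCycle (G : Multigraph V) : Prop :=
  ∃ a b c d : V, a ≠ b ∧ a ≠ c ∧ a ≠ d ∧ b ≠ c ∧ b ≠ d ∧ c ≠ d ∧
    s(a, b) ∈ G.edges ∧ s(b, c) ∈ G.edges ∧ s(c, d) ∈ G.edges ∧ s(d, a) ∈ G.edges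

/-- `M` is a matching: distinct edges share no endpoint. -/
def IsMatching (M : Multiset (Sym2 V)) : Prop :=
  M.Nodup ∧ ∀ e ∈ M, ∀ f ∈ M, e ≠ f → ∀ x : V, x ∈ e → x ∉ f

/-- `{X, Y}` is a bipartition (of the full vertex set) for the edge multiset `E`:
every edge has one end in `X` and one end in `Y`. -/
def IsBipartition [Fintype V] (X Y : Finset V) (E : Multiset (Sym2 V)) : Prop :=
  Disjoint X Y ∧ X ∪ Y = Finset.univ ∧
    ∀ e ∈ E, (∃ a ∈ e, a ∈ X) ∧ (∃ b ∈ e, b ∈ Y)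

/-- The edge multiset of Catlin's π-reduction `G/π` obtained from the induced four-cycle
`u v z w`: remove the four cycle edges, identify `z` with `u` (forming `x = u`) and `w` with
`v` (forming `y = v`), and add the new edge `e_π = xy = s(u, v)`. -/
noncomputable def piEdges (G : Multigraph V) (u v z w : V) : Multiset (Sym2 V) :=
  ((G.edges - {s(u, v), s(v, z), s(z, w), s(w, u)}).map
      (Sym2.map fun a => if a = z then u else if a = w then v else a)) + {s(u, v)}

/-- `(S, E)` is the multigraph `Φ(c, t)`: a star `K_{1,t}` with centre `c` in which every
edge is doubled. -/
def IsPhi (S : Set V) (E : Multiset (Sym2 V)) (c : V) (t : ℕ) : Prop :=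
  ∃ A : Finset V, c ∉ A ∧ A.card = t ∧ S = insert c (↑A : Set V) ∧
    E = A.val.map (fun a => s(c, a)) + A.val.map (fun a => s(c, a))

/-- The multigraph associated with a simple graph. -/
noncomputable def ofSimple [Fintype V] (G : SimpleGraph V) : Multigraph V where
  edges := G.edgeSet.toFinset.val
  loopless := by
    intro e he
    have he' : e ∈ G.edgeSet := by simpa using he
    exact G.not_isDiag_of_mem_edgeSet he'

/-- Isomorphism of multigraphs. -/
def MIso {A B : Type} (G : Multigraph A) (H : Multigraph B) : Prop :=
  ∃ φ : A ≃ B, H.edges = G.edges.map (Sym2.map φ)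

end Multigraph

/-- Vertices of the Petersen graph: the 2-element subsets of a 5-element set. -/
abbrev PetersenVert : Type := {s : Finset (Fin 5) // s.card = 2}

/-- The Petersen graph (as the Kneser graph on 2-subsets of a 5-set). -/
def petersenSimple : SimpleGraph PetersenVert :=
  SimpleGraph.fromRel fun a b => Disjoint a.1 b.1

noncomputable def petersen : Multigraph PetersenVert :=
  Multigraph.ofSimple petersenSimple

/-- The graph `P₁₄`: obtained from the Petersen graph (outer cycle `0 1 2 3 4`, spokes
`i — i+5`, inner cycle `5 7 9 6 8 5`) by replacing the vertex `9` (whose neighbours were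
`4`, `7`, `6`) by a copy of `K_{2,3}` with degree-three vertices `9`, `10` and degree-two
vertices `11`, `12`, `13`, joined to `4`, `7`, `6` respectively. -/
def p14Simple : SimpleGraph (Fin 14) :=
  SimpleGraph.fromRel fun a b =>
    (a, b) ∈ ([(0, 1), (1, 2), (2, 3), (3, 4), (4, 0), (0, 5), (1, 6), (2, 7), (3, 8),
      (5, 7), (6, 8), (8, 5), (9, 11), (9, 12), (9, 13), (10, 11), (10, 12), (10, 13),
      (11, 4), (12, 7), (13, 6)] : List (Fin 14 × Fin 14))

noncomputable def p14 : Multigraph (Fin 14) :=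
  Multigraph.ofSimple p14Simple

namespace HamSearch

/-- Boolean membership test. -/
noncomputable def memb (a : ℕ) (l : List ℕ) : Bool :=
  List.rec (motive := fun _ => Bool) false
    (fun b _ ih => Bool.rec (motive := fun _ => Bool) ih true (Nat.beq a b)) l

/-- The entry of a list at a position. -/
noncomputable def getN (l : List ℕ) : ℕ → ℕ :=
  List.rec (motive := fun _ => ℕ → ℕ) (fun _ => 0)
    (fun a _ ih k => Nat.rec (motive := fun _ => ℕ) a (fun k _ => ih k) k) l

/-- The row of a table at a position. -/
noncomputable def getL (l : List (List ℕ)) : ℕ → List ℕ :=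
  List.rec (motive := fun _ => ℕ → List ℕ) (fun _ => [])
    (fun a _ ih k => Nat.rec (motive := fun _ => List ℕ) a (fun k _ => ih k) k) l

noncomputable def anyL (f : ℕ → Bool) (l : List ℕ) : Bool :=
  List.rec (motive := fun _ => Bool) false
    (fun b _ ih => Bool.rec (motive := fun _ => Bool) ih true (f b)) l

noncomputable def allL (f : ℕ → Bool) (l : List ℕ) : Bool :=
  List.rec (motive := fun _ => Bool) true
    (fun b _ ih => Bool.rec (motive := fun _ => Bool) false ih (f b)) l

/-- Depth first search for a Hamilton path that ends in a neighbour of `0`. -/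
noncomputable def ham (N : List (List ℕ)) (k : ℕ) : ℕ → List ℕ → Bool :=
  Nat.rec (motive := fun _ => ℕ → List ℕ → Bool) (fun cur _ => memb 0 (getL N cur))
    (fun _ ih cur vis => anyL (fun w =>
      Bool.rec (motive := fun _ => Bool) (ih w (w :: vis)) false (memb w vis)) (getL N cur)) k

/-- Test `P` on all repetition-free lists whose entries come from the given candidates. -/
noncomputable def enum (P : List ℕ → Bool) (cs : List (List ℕ)) : List ℕ → Bool :=
  List.rec (motive := fun _ => List ℕ → Bool) (fun acc => P acc.reverse)
    (fun c _ ih acc => allL (fun v =>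
      Bool.rec (motive := fun _ => Bool) (ih (v :: acc)) true (memb v acc)) c) cs

/-- Adjacency table: `i` stands for the `i`-th `x`, `n + j` for the `j`-th `y`. -/
noncomputable def table (n : ℕ) (s t : List ℕ) : List (List ℕ) :=
  ((List.range n).map fun i => [n + i, n + getN s i, n + getN t i]) ++
  ((List.range n).map fun j => (List.range n).filter fun i => memb j [i, getN s i, getN t i])

/-- Replace a number by an equal numeral of the list, if there is one. -/
noncomputable def pick (l : List ℕ) (w : ℕ) (k : ℕ → Bool) : Bool :=
  List.rec (motive := fun _ => Bool) (k w)
    (fun a _ ih => Bool.rec (motive := fun _ => Bool) ih (k a) (Nat.beq a w)) l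

noncomputable def forceRow (lits : List ℕ) (l : List ℕ) : (List ℕ → Bool) → Bool :=
  List.rec (motive := fun _ => (List ℕ → Bool) → Bool) (fun k => k [])
    (fun w _ ih k => pick lits w fun a => ih fun rest => k (a :: rest)) l

/-- Evaluate a table before it is used. -/
noncomputable def forceTab (lits : List ℕ) (l : List (List ℕ)) : (List (List ℕ) → Bool) → Bool :=
  List.rec (motive := fun _ => (List (List ℕ) → Bool) → Bool) (fun k => k [])
    (fun w _ ih k => forceRow lits w fun a => ih fun rest => k (a :: rest)) l

theorem pick_eq (l : List ℕ) (w : ℕ) (k : ℕ → Bool) : pick l w k = k w := by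
  induction l with
  | nil => rfl
  | cons a l ih =>
    change Bool.rec (motive := fun _ => Bool) (pick l w k) (k a) (Nat.beq a w) = k w
    rw [ih]
    cases h : Nat.beq a w
    · rfl
    · rw [Nat.eq_of_beq_eq_true h]

theorem forceRow_eq (l r : List ℕ) (k : List ℕ → Bool) : forceRow l r k = k r := by
  induction r generalizing k with
  | nil => rfl
  | cons a r ih =>
    change pick l a (fun a => forceRow l r fun rest => k (a :: rest)) = _
    rw [pick_eq, ih]

theorem forceTab_eq (l : List ℕ) (r : List (List ℕ)) (k : List (List ℕ) → Bool) :
    forceTab l r k = k r := by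
  induction r generalizing k with
  | nil => rfl
  | cons a r ih =>
    change forceRow l a (fun a => forceTab l r fun rest => k (a :: rest)) = _
    rw [forceRow_eq, ih]

/-- The numerals that occur in the tables. -/
def lits : List ℕ := [0, 1, 2, 3, 4, 5, 6, 7, 8, 9, 10, 11, 12, 13]

noncomputable def good (n : ℕ) (s : List ℕ) (cyc : List (List ℕ)) (t : List ℕ) : Bool :=
  cyc.any (fun S => allL (fun i => memb (getN t i) S) S) ||
    forceTab lits (table n s t) fun N => ham N (2*n-1) 0 [0]

noncomputable def cands (n : ℕ) (s : List ℕ) : List (List ℕ) :=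
  (List.range n).map fun i => (List.range n).filter fun j => !memb j [i, getN s i]

noncomputable def full (n : ℕ) (s : List ℕ) (cyc : List (List ℕ)) : Bool :=
  (forceTab lits (table n s s) fun N => ham N (2*n-1) 0 [0]) || enum (good n s cyc) (cands n s) []

theorem memb_iff (a : ℕ) (l : List ℕ) : memb a l = true ↔ a ∈ l := by
  induction l with
  | nil => simp [memb]
  | cons b l ih =>
    change Bool.rec (motive := fun _ => Bool) (memb a l) true (Nat.beq a b) = true ↔ _
    cases h : Nat.beq a b
    · have := Nat.ne_of_beq_eq_false h
      simp [ih, this]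
    · simp [Nat.eq_of_beq_eq_true h]

theorem getN_eq (l : List ℕ) (i : ℕ) : getN l i = l.getD i 0 := by
  induction l generalizing i with
  | nil => simp [getN]
  | cons b l ih =>
    cases i with
    | zero => rfl
    | succ i => exact ih i

theorem getL_eq (l : List (List ℕ)) (i : ℕ) : getL l i = l.getD i [] := by
  induction l generalizing i with
  | nil => simp [getL]
  | cons b l ih =>
    cases i with
    | zero => rfl
    | succ i => exact ih i

theorem anyL_iff (f : ℕ → Bool) (l : List ℕ) : anyL f l = true ↔ ∃ a ∈ l, f a = true := by
  induction l with
  | nil => simp [anyL]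
  | cons b l ih =>
    change Bool.rec (motive := fun _ => Bool) (anyL f l) true (f b) = true ↔ _
    cases h : f b <;> simp [ih, h]

theorem allL_iff (f : ℕ → Bool) (l : List ℕ) : allL f l = true ↔ ∀ a ∈ l, f a = true := by
  induction l with
  | nil => simp [allL]
  | cons b l ih =>
    change Bool.rec (motive := fun _ => Bool) false (allL f l) (f b) = true ↔ _
    cases h : f b <;> simp [ih, h]

theorem enum_sound (P : List ℕ → Bool) (l : List ℕ) (cs : List (List ℕ)) (acc : List ℕ)
    (h : enum P cs acc = true) (hl : List.Forall₂ (· ∈ ·) l cs)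
    (hd : ∀ x ∈ l, x ∉ acc) (hn : l.Nodup) : P (acc.reverse ++ l) = true := by
  induction hl generalizing acc with
  | nil => simpa [enum] using h
  | @cons a c l cs hac hl ih =>
    change allL (fun v =>
      Bool.rec (motive := fun _ => Bool) (enum P cs (v :: acc)) true (memb v acc)) c = true at h
    rw [allL_iff] at h
    have h1 := h a hac
    have h2 : memb a acc = false := by
      rw [Bool.eq_false_iff, ne_eq, memb_iff]; exact hd a (by simp)
    rw [h2] at h1
    have h3 := ih (a :: acc) h1 (by
      intro x hx
      rw [List.nodup_cons] at hn
      simp only [List.mem_cons, not_or]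
      exact ⟨fun e => hn.1 (e ▸ hx), hd x (by simp [hx])⟩) (List.nodup_cons.1 hn).2
    simpa using h3

theorem getL_table_x (n : ℕ) (s t : List ℕ) (i : ℕ) (hi : i < n) :
    getL (table n s t) i = [n + i, n + getN s i, n + getN t i] := by
  rw [getL_eq, table, List.getD_append _ _ _ _ (by simpa using hi)]
  simp [List.getD_eq_getElem?_getD, hi]

theorem getL_table_y (n : ℕ) (s t : List ℕ) (j : ℕ) (hj : j < n) :
    getL (table n s t) (n + j) =
      (List.range n).filter fun i => memb j [i, getN s i, getN t i] := by
  rw [getL_eq, table, List.getD_append_right _ _ _ _ (by simp)]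
  simp [List.getD_eq_getElem?_getD, hj]

theorem getN_ofFn {n : ℕ} (f : Fin n → Fin n) (i : Fin n) :
    getN (List.ofFn fun i => (f i : ℕ)) i = f i := by
  rw [getN_eq]
  simp [List.getD_eq_getElem?_getD]

open SimpleGraph

theorem ham_sound {V : Type} (G : SimpleGraph V) (m : ℕ) (v : ℕ → V) (N : List (List ℕ))
    (hinj : ∀ a < m, ∀ b < m, v a = v b → a = b)
    (hN : ∀ a < m, ∀ b ∈ getL N a, b < m ∧ G.Adj (v a) (v b))
    (k cur : ℕ) (vis : List ℕ) (hvis : ∀ z ∈ vis, z < m) (hcur : cur ∈ vis)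
    (h : ham N k cur vis = true) :
    ∃ u, ∃ p : G.Walk (v cur) u, p.length = k ∧ p.IsPath ∧ G.Adj u (v 0) ∧
      ∀ z ∈ vis, z ≠ cur → v z ∉ p.support := by
  induction k generalizing cur vis with
  | zero =>
    change memb 0 (getL N cur) = true at h
    rw [memb_iff] at h
    refine ⟨v cur, Walk.nil, rfl, Walk.IsPath.nil, (hN cur (hvis _ hcur) 0 h).2, ?_⟩
    intro z hz hzc
    simp only [Walk.support_nil, List.mem_singleton]
    exact fun e => hzc (hinj _ (hvis _ hz) _ (hvis _ hcur) e)
  | succ k ih =>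
    change anyL (fun w => Bool.rec (motive := fun _ => Bool) (ham N k w (w :: vis)) false
      (memb w vis)) (getL N cur) = true at h
    rw [anyL_iff] at h
    obtain ⟨w, hw, hw2⟩ := h
    have hwv : w ∉ vis := by
      intro hh
      rw [← memb_iff] at hh
      simp [hh] at hw2
    have hw3 : ham N k w (w :: vis) = true := by
      cases hm : memb w vis <;> simp [hm] at hw2
      exact hw2
    obtain ⟨hwm, hadj⟩ := hN cur (hvis _ hcur) w hw
    obtain ⟨u, p, hl, hp, hu, hz⟩ := ih w (w :: vis) (by
      intro z hz
      rcases List.mem_cons.1 hz with rfl | hz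
      · exact hwm
      · exact hvis _ hz) (by simp) hw3
    refine ⟨u, Walk.cons hadj p, by simp [hl], ?_, hu, ?_⟩
    · rw [Walk.cons_isPath_iff]
      exact ⟨hp, hz cur (by simp [hcur]) (fun e => hwv (e ▸ hcur))⟩
    · intro z hzv hzc
      rw [Walk.support_cons, List.mem_cons, not_or]
      exact ⟨fun e => hzc (hinj _ (hvis _ hzv) _ (hvis _ hcur) e),
        hz z (by simp [hzv]) (fun e => hwv (e ▸ hzv))⟩

/-- A cubic bipartite graph presented by two permutations. -/
structure Model {V : Type} (G : SimpleGraph V) {n : ℕ} (xs ys : Fin n → V)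
    (σ τ : Equiv.Perm (Fin n)) : Prop where
  bij : Function.Bijective (Sum.elim xs ys)
  adj : ∀ i j, j = i ∨ j = σ i ∨ j = τ i → G.Adj (xs i) (ys j)
  conn : ∀ S : Set (Fin n), S.Nonempty → (∀ i ∈ S, σ i ∈ S ∧ τ i ∈ S) → ∀ i, i ∈ S
  ne1 : ∀ i, σ i ≠ i
  ne2 : ∀ i, τ i ≠ i
  ne3 : ∀ i, τ i ≠ σ i

theorem Model.conj {V : Type} {G : SimpleGraph V} {n : ℕ} {xs ys : Fin n → V}
    {σ τ : Equiv.Perm (Fin n)} (M : Model G xs ys σ τ) (c : Equiv.Perm (Fin n)) :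
    Model G (xs ∘ c.symm) (ys ∘ c.symm) (c * σ * c⁻¹) (c * τ * c⁻¹) where
  bij := by
    have : Sum.elim (xs ∘ c.symm) (ys ∘ c.symm) = Sum.elim xs ys ∘ (Equiv.sumCongr c.symm c.symm) := by
      ext z; rcases z with z | z <;> simp
    rw [this]
    exact M.bij.comp (Equiv.bijective _)
  adj := by
    intro i j h
    apply M.adj
    rcases h with h | h | h
    · left; rw [h]
    · right; left; rw [h]; simp [Equiv.Perm.inv_def]
    · right; right; rw [h]; simp [Equiv.Perm.inv_def]
  conn := by
    intro S hS h i
    have := M.conn (c ⁻¹' S) (by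
      obtain ⟨s, hs⟩ := hS
      exact ⟨c.symm s, by simpa using hs⟩) (by
      intro i hi
      have := h (c i) hi
      simpa using this) (c.symm i)
    simpa using this
  ne1 := by
    intro i h
    apply M.ne1 (c.symm i)
    rw [Equiv.eq_symm_apply]
    simpa [Equiv.Perm.inv_def] using h
  ne2 := by
    intro i h
    apply M.ne2 (c.symm i)
    rw [Equiv.eq_symm_apply]
    simpa [Equiv.Perm.inv_def] using h
  ne3 := by
    intro i h
    apply M.ne3 (c.symm i)
    simpa [Equiv.Perm.inv_def] using h

/-- A closed trail through all vertices. -/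
def HasTour {V : Type} (G : SimpleGraph V) : Prop :=
  ∃ u, ∃ p : G.Walk u u, p.IsTrail ∧ ∀ w, w ∈ p.support

theorem tour_of_path {V : Type} [Fintype V] (G : SimpleGraph V) {a u : V} (p : G.Walk a u)
    (hp : p.IsPath) (hl : p.length + 1 = Fintype.card V) (h3 : 2 < Fintype.card V)
    (hu : G.Adj u a) : HasTour G := by
  refine ⟨u, Walk.cons hu p, ?_, ?_⟩
  · rw [Walk.isTrail_cons]
    refine ⟨hp.isTrail, fun h => ?_⟩
    rw [Sym2.eq_swap] at h
    have := hp.length_eq_one_of_mem_edges h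
    omega
  · intro w
    rw [Walk.support_cons, List.mem_cons]
    right
    have hc : p.support.toFinset = Finset.univ := by
      apply Finset.eq_univ_of_card
      rw [List.toFinset_card_of_nodup hp.support_nodup, Walk.length_support, hl]
    have := Finset.mem_univ w
    rw [← hc] at this
    simpa using this

theorem tour_of_ham {V : Type} [Fintype V] {G : SimpleGraph V} {n : ℕ} {xs ys : Fin n → V}
    {σ τ : Equiv.Perm (Fin n)} (M : Model G xs ys σ τ) {σ' τ' : Fin n → Fin n} (hn : 2 ≤ n)
    (hσ' : ∀ i, σ' i = σ i ∨ σ' i = τ i) (hτ' : ∀ i, τ' i = σ i ∨ τ' i = τ i)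
    (h1 : ham (table n (List.ofFn fun i => (σ' i : ℕ)) (List.ofFn fun i => (τ' i : ℕ)))
      (2*n-1) 0 [0] = true) : HasTour G := by
  have hn0 : NeZero n := ⟨by omega⟩
  let v : ℕ → V := fun k => if k < n then xs (Fin.ofNat n k) else ys (Fin.ofNat n (k - n))
  have vx : ∀ i : Fin n, v i = xs i := by
    intro i
    simp [v]
  have vy : ∀ i : Fin n, v (n + i) = ys i := by
    intro i
    simp [v]
  have cases2 : ∀ a < 2 * n, (∃ i : Fin n, a = i) ∨ ∃ i : Fin n, a = n + i := by
    intro a ha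
    by_cases h : a < n
    · exact Or.inl ⟨⟨a, h⟩, rfl⟩
    · exact Or.inr ⟨⟨a - n, by omega⟩, by simp; omega⟩
  have inj := M.bij.1
  have hcard : Fintype.card V = 2 * n := by
    rw [← Fintype.card_of_bijective M.bij]; simp; omega
  obtain ⟨u, p, hl, hp, hu, -⟩ := ham_sound G (2 * n) v (table n _ _) (by
    intro a ha b hb hab
    rcases cases2 a ha with ⟨i, rfl⟩ | ⟨i, rfl⟩ <;> rcases cases2 b hb with ⟨j, rfl⟩ | ⟨j, rfl⟩
    · rw [vx, vx] at hab
      have := @inj (Sum.inl i) (Sum.inl j) hab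
      simpa [Fin.ext_iff] using this
    · rw [vx, vy] at hab
      have := @inj (Sum.inl i) (Sum.inr j) hab
      simp at this
    · rw [vx, vy] at hab
      have := @inj (Sum.inr i) (Sum.inl j) hab
      simp at this
    · rw [vy, vy] at hab
      have := @inj (Sum.inr i) (Sum.inr j) hab
      simpa [Fin.ext_iff] using this) (by
    intro a ha b hb
    rcases cases2 a ha with ⟨i, rfl⟩ | ⟨i, rfl⟩
    · rw [getL_table_x _ _ _ _ i.2, getN_ofFn σ', getN_ofFn τ'] at hb
      simp only [List.mem_cons, List.not_mem_nil, or_false] at hb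
      rcases hb with rfl | rfl | rfl
      · exact ⟨by omega, by rw [vx, vy]; exact M.adj _ _ (Or.inl rfl)⟩
      · exact ⟨by omega, by rw [vx, vy]; exact M.adj _ _ (Or.inr (hσ' _))⟩
      · exact ⟨by omega, by rw [vx, vy]; exact M.adj _ _ (Or.inr (hτ' _))⟩
    · rw [getL_table_y _ _ _ _ i.2] at hb
      simp only [List.mem_filter, List.mem_range, memb_iff] at hb
      obtain ⟨hbn, hb⟩ := hb
      lift b to Fin n using hbn
      rw [getN_ofFn σ', getN_ofFn τ'] at hb
      refine ⟨by omega, ?_⟩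
      rw [vx, vy]
      refine (M.adj _ _ ?_).symm
      simp only [List.mem_cons, List.not_mem_nil, or_false, ← Fin.ext_iff] at hb
      rcases hb with hb | hb | hb
      · exact Or.inl hb
      · rw [hb]; exact Or.inr (hσ' _)
      · rw [hb]; exact Or.inr (hτ' _)) _ 0 [0] (by simp; omega) (by simp) h1
  exact tour_of_path G p hp (by omega) (by omega) hu

theorem tour_of_full {V : Type} [Fintype V] {G : SimpleGraph V} {n : ℕ} {xs ys : Fin n → V}
    {σ τ : Equiv.Perm (Fin n)} (M : Model G xs ys σ τ) (hn : 2 ≤ n) (cyc : List (List ℕ))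
    (hcyc : ∀ S ∈ cyc, (∃ i : Fin n, (i : ℕ) ∈ S) ∧ (∃ i : Fin n, (i : ℕ) ∉ S) ∧
      ∀ i : Fin n, (i : ℕ) ∈ S → (σ i : ℕ) ∈ S)
    (hf : full n (List.ofFn fun i => (σ i : ℕ)) cyc = true) : HasTour G := by
  set s := List.ofFn fun i => (σ i : ℕ) with hs
  set t := List.ofFn fun i => (τ i : ℕ) with ht
  have hsi : ∀ i : Fin n, getN s i = σ i := fun i => getN_ofFn σ i
  have hti : ∀ i : Fin n, getN t i = τ i := fun i => getN_ofFn τ i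
  rw [full, Bool.or_eq_true, forceTab_eq] at hf
  rcases hf with hf | hf
  · exact tour_of_ham M (σ' := σ) (τ' := σ) hn (fun i => Or.inl rfl) (fun i => Or.inl rfl) hf
  have h1 := enum_sound _ t _ [] hf (by
    rw [List.forall₂_iff_get]
    refine ⟨by simp [ht, cands], ?_⟩
    intro i h1 h2
    have hi : i < n := by simpa [ht] using h1
    have e := hsi ⟨i, hi⟩
    simp only [] at e
    simp only [cands, List.get_eq_getElem, List.getElem_map, List.getElem_range, e,
      List.mem_filter, List.mem_range]
    simp only [ht, List.getElem_ofFn]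
    refine ⟨(τ ⟨i, hi⟩).2, ?_⟩
    rw [Bool.not_eq_true', Bool.eq_false_iff, ne_eq, memb_iff]
    simp only [List.mem_cons, List.not_mem_nil, or_false, not_or]
    exact ⟨fun h => M.ne2 ⟨i, hi⟩ (Fin.ext h), fun h => M.ne3 ⟨i, hi⟩ (Fin.ext h)⟩)
    (by simp) (by
      rw [ht, List.nodup_ofFn]
      exact Fin.val_injective.comp τ.injective)
  simp only [List.reverse_nil, List.nil_append, good, forceTab_eq, Bool.or_eq_true, List.any_eq_true] at h1
  rcases h1 with ⟨S, hS, hS2⟩ | h1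
  · exfalso
    obtain ⟨⟨a, ha⟩, ⟨b, hb⟩, hc⟩ := hcyc S hS
    rw [allL_iff] at hS2
    refine hb (M.conn {i | (i : ℕ) ∈ S} ⟨a, ha⟩ ?_ b)
    intro i hi
    refine ⟨hc i hi, ?_⟩
    have := hS2 i hi
    rw [memb_iff, hti] at this
    exact this
  · exact tour_of_ham M (σ' := σ) (τ' := τ) hn (fun i => Or.inl rfl) (fun i => Or.inr rfl) h1

theorem tour_of_conj {V : Type} [Fintype V] {G : SimpleGraph V} {n : ℕ} {xs ys : Fin n → V}
    {σ τ : Equiv.Perm (Fin n)} (M : Model G xs ys σ τ) (hn : 2 ≤ n) (cyc : List (List ℕ))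
    (σ₀ : Equiv.Perm (Fin n)) (hct : σ.cycleType = σ₀.cycleType)
    (hcyc : ∀ S ∈ cyc, (∃ i : Fin n, (i : ℕ) ∈ S) ∧ (∃ i : Fin n, (i : ℕ) ∉ S) ∧
      ∀ i : Fin n, (i : ℕ) ∈ S → (σ₀ i : ℕ) ∈ S)
    (hf : full n (List.ofFn fun i => (σ₀ i : ℕ)) cyc = true) : HasTour G := by
  rw [← Equiv.Perm.isConj_iff_cycleType_eq, isConj_iff] at hct
  obtain ⟨c, rfl⟩ := hct
  exact tour_of_full (M.conj c) hn cyc hcyc hf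

/-- A permutation from two tables. -/
def mk (n : ℕ) (f g : Fin n → Fin n) (h1 : ∀ i, g (f i) = i) (h2 : ∀ i, f (g i) = i) :
    Equiv.Perm (Fin n) := ⟨f, g, h1, h2⟩

set_option maxHeartbeats 4000000 in
theorem tour {V : Type} [Fintype V] {G : SimpleGraph V} {n : ℕ} {xs ys : Fin n → V}
    {σ τ : Equiv.Perm (Fin n)} (M : Model G xs ys σ τ) (hn : 2 ≤ n) (hn7 : n ≤ 7) :
    HasTour G := by
  have hsum : σ.cycleType.sum = n := by
    rw [Equiv.Perm.sum_cycleType]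
    have : σ.support = Finset.univ := by
      ext i; simp [M.ne1 i]
    simp [this]
  have h2 : ∀ a ∈ σ.cycleType, 2 ≤ a := fun a ha => Equiv.Perm.two_le_of_mem_cycleType ha
  have hc : Multiset.card σ.cycleType ≤ 3 := by
    have := Multiset.card_nsmul_le_sum h2
    rw [hsum] at this
    simp at this
    omega
  have key : σ.cycleType = {n} ∨ ∃ a b, 2 ≤ b ∧ b ≤ a ∧ a + b = n ∧ σ.cycleType = {a, b} ∨
      2 ≤ b ∧ 2 ≤ a ∧ a + b + 2 = n ∧ b ≤ a ∧ σ.cycleType = {a, b, 2} := by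
    have e3 : Multiset.card σ.cycleType = 0 ∨ Multiset.card σ.cycleType = 1 ∨
        Multiset.card σ.cycleType = 2 ∨ Multiset.card σ.cycleType = 3 := by omega
    rcases e3 with e | e | e | e
    · rw [Multiset.card_eq_zero] at e
      rw [e] at hsum
      simp at hsum
      omega
    · rw [Multiset.card_eq_one] at e
      obtain ⟨a, e⟩ := e
      rw [e] at hsum
      simp at hsum
      left
      rw [e, hsum]
    · rw [Multiset.card_eq_two] at e
      obtain ⟨a, b, e⟩ := e
      rw [e] at hsum h2
      simp at hsum h2
      right
      rcases le_total b a with h | h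
      · exact ⟨a, b, Or.inl ⟨h2.2, h, hsum, e⟩⟩
      · exact ⟨b, a, Or.inl ⟨h2.1, h, by omega, by rw [e]; exact Multiset.pair_comm _ _⟩⟩
    · rw [Multiset.card_eq_three] at e
      obtain ⟨a, b, c, e⟩ := e
      rw [e] at hsum h2
      simp at hsum h2
      right
      have hcase : (n = 6 ∧ a = 2 ∧ b = 2 ∧ c = 2) ∨ (n = 7 ∧ a = 3 ∧ b = 2 ∧ c = 2) ∨
        (n = 7 ∧ a = 2 ∧ b = 3 ∧ c = 2) ∨ (n = 7 ∧ a = 2 ∧ b = 2 ∧ c = 3) := by omega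
      rcases hcase with ⟨h, rfl, rfl, rfl⟩ | ⟨h, rfl, rfl, rfl⟩ | ⟨h, rfl, rfl, rfl⟩ |
        ⟨h, rfl, rfl, rfl⟩
      · exact ⟨2, 2, Or.inr ⟨le_rfl, le_rfl, by omega, le_rfl, e⟩⟩
      · exact ⟨3, 2, Or.inr ⟨le_rfl, by omega, by omega, by omega, e⟩⟩
      · exact ⟨3, 2, Or.inr ⟨le_rfl, by omega, by omega, by omega, by rw [e]; decide⟩⟩
      · exact ⟨3, 2, Or.inr ⟨le_rfl, by omega, by omega, by omega, by rw [e]; decide⟩⟩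
  rcases key with h | ⟨a, b, ⟨hb, hba, hab, h⟩ | ⟨hb, ha, hab, hba, h⟩⟩
  · interval_cases n
    · exact tour_of_conj M hn [] (mk 2 ![1,0] ![1,0] (by decide) (by decide))
        (by rw [h]; decide +kernel) (by simp) (by decide +kernel)
    · exact tour_of_conj M hn [] (mk 3 ![1,2,0] ![2,0,1] (by decide) (by decide))
        (by rw [h]; decide +kernel) (by simp) (by decide +kernel)
    · exact tour_of_conj M hn [] (mk 4 ![1,2,3,0] ![3,0,1,2] (by decide) (by decide))
        (by rw [h]; decide +kernel) (by simp) (by decide +kernel)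
    · exact tour_of_conj M hn [] (mk 5 ![1,2,3,4,0] ![4,0,1,2,3] (by decide) (by decide))
        (by rw [h]; decide +kernel) (by simp) (by decide +kernel)
    · exact tour_of_conj M hn [] (mk 6 ![1,2,3,4,5,0] ![5,0,1,2,3,4] (by decide) (by decide))
        (by rw [h]; decide +kernel) (by simp) (by decide +kernel)
    · exact tour_of_conj M hn [] (mk 7 ![1,2,3,4,5,6,0] ![6,0,1,2,3,4,5] (by decide) (by decide))
        (by rw [h]; decide +kernel) (by simp) (by decide +kernel)
  · have hcase : (n = 4 ∧ a = 2 ∧ b = 2) ∨ (n = 5 ∧ a = 3 ∧ b = 2) ∨ (n = 6 ∧ a = 4 ∧ b = 2) ∨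
        (n = 6 ∧ a = 3 ∧ b = 3) ∨ (n = 7 ∧ a = 5 ∧ b = 2) ∨ (n = 7 ∧ a = 4 ∧ b = 3) := by
      omega
    rcases hcase with ⟨rfl, rfl, rfl⟩ | ⟨rfl, rfl, rfl⟩ | ⟨rfl, rfl, rfl⟩ | ⟨rfl, rfl, rfl⟩ |
      ⟨rfl, rfl, rfl⟩ | ⟨rfl, rfl, rfl⟩
    · exact tour_of_conj M hn [[0, 1]] (mk 4 ![1,0,3,2] ![1,0,3,2] (by decide) (by decide))
        (by rw [h]; decide +kernel) (by decide +kernel) (by decide +kernel)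
    · exact tour_of_conj M hn [[3, 4]] (mk 5 ![1,2,0,4,3] ![2,0,1,4,3] (by decide) (by decide))
        (by rw [h]; decide +kernel) (by decide +kernel) (by decide +kernel)
    · exact tour_of_conj M hn [[4, 5]] (mk 6 ![1,2,3,0,5,4] ![3,0,1,2,5,4] (by decide) (by decide))
        (by rw [h]; decide +kernel) (by decide +kernel) (by decide +kernel)
    · exact tour_of_conj M hn [[0, 1, 2]] (mk 6 ![1,2,0,4,5,3] ![2,0,1,5,3,4] (by decide) (by decide))
        (by rw [h]; decide +kernel) (by decide +kernel) (by decide +kernel)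
    · exact tour_of_conj M hn [[5, 6]]
        (mk 7 ![1,2,3,4,0,6,5] ![4,0,1,2,3,6,5] (by decide) (by decide))
        (by rw [h]; decide +kernel) (by decide +kernel) (by decide +kernel)
    · exact tour_of_conj M hn [[4, 5, 6]]
        (mk 7 ![1,2,3,0,5,6,4] ![3,0,1,2,6,4,5] (by decide) (by decide))
        (by rw [h]; decide +kernel) (by decide +kernel) (by decide +kernel)
  · have hcase : (n = 6 ∧ a = 2 ∧ b = 2) ∨ (n = 7 ∧ a = 3 ∧ b = 2) := by
      omega
    rcases hcase with ⟨rfl, rfl, rfl⟩ | ⟨rfl, rfl, rfl⟩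
    · exact tour_of_conj M hn [[0, 1], [2, 3], [4, 5]]
        (mk 6 ![1,0,3,2,5,4] ![1,0,3,2,5,4] (by decide) (by decide))
        (by rw [h]; decide +kernel) (by decide +kernel) (by decide +kernel)
    · exact tour_of_conj M hn [[0, 1, 2], [3, 4], [5, 6]]
        (mk 7 ![1,2,0,4,3,6,5] ![2,0,1,4,3,6,5] (by decide) (by decide))
        (by rw [h]; decide +kernel) (by decide +kernel) (by decide +kernel)

end HamSearch
namespace Multigraph

open HamSearch

theorem exists_matching {α β : Type} [Fintype α] [Fintype β] (r : α → β → Prop) (k : ℕ)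
    (hk : 0 < k) (ha : ∀ a, (Finset.univ.filter fun b => r a b).card = k)
    (hb : ∀ b, (Finset.univ.filter fun a => r a b).card = k)
    (hc : Fintype.card α = Fintype.card β) :
    ∃ f : α ≃ β, ∀ a, r a (f a) := by
  obtain ⟨f, hf, hr⟩ := (Fintype.all_card_le_filter_rel_iff_exists_injective r).1 (by
    intro A
    have := Finset.card_nsmul_le_card_nsmul (R := ℕ) (s := A)
      (t := Finset.univ.filter fun b => ∃ a ∈ A, r a b) r (m := k) (n := k) (by
        intro a haA
        rw [← ha a]
        simp only [Nat.cast_id]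
        apply Finset.card_le_card
        intro b hb
        simp only [Finset.mem_filter, Finset.mem_univ, true_and] at hb
        simp only [Finset.mem_bipartiteAbove, Finset.mem_filter, Finset.mem_univ, true_and]
        exact ⟨⟨a, haA, hb⟩, hb⟩) (by
        intro b _
        rw [← hb b]
        simp only [Nat.cast_id]
        apply Finset.card_le_card
        intro a ha
        simp only [Finset.mem_bipartiteBelow] at ha
        simpa using ha.2)
    simp only [smul_eq_mul] at this
    exact Nat.le_of_mul_le_mul_right this hk)
  exact ⟨Equiv.ofBijective f ((Fintype.bijective_iff_injective_and_card f).2 ⟨hf, hc⟩), hr⟩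

theorem remove_matching {α : Type} [Fintype α] (r : α → α → Prop) (k : ℕ)
    (ha : ∀ a, (Finset.univ.filter fun b => r a b).card = k + 1)
    (hb : ∀ b, (Finset.univ.filter fun a => r a b).card = k + 1)
    (f : α ≃ α) (hf : ∀ a, r a (f a)) (r' : α → α → Prop)
    (hr' : ∀ a b, r' a b ↔ r a b ∧ b ≠ f a) :
    (∀ a, (Finset.univ.filter fun b => r' a b).card = k) ∧
    (∀ b, (Finset.univ.filter fun a => r' a b).card = k) := by
  constructor
  · intro a
    have : (Finset.univ.filter fun b => r' a b) =
        (Finset.univ.filter fun b => r a b).erase (f a) := by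
      ext b; simp [hr', and_comm]
    rw [this, Finset.card_erase_of_mem (by simp [hf]), ha]; rfl
  · intro b
    have : (Finset.univ.filter fun a => r' a b) =
        (Finset.univ.filter fun a => r a b).erase (f.symm b) := by
      ext a; simp [hr', and_comm, Equiv.eq_symm_apply, eq_comm]
    rw [this, Finset.card_erase_of_mem (by simpa using hf (f.symm b)), hb]; rfl

theorem three_factors {α : Type} [Fintype α] (r : α → α → Prop)
    (ha : ∀ a, (Finset.univ.filter fun b => r a b).card = 3)
    (hb : ∀ b, (Finset.univ.filter fun a => r a b).card = 3) :
    ∃ f g h : α ≃ α, (∀ a, f a ≠ g a ∧ f a ≠ h a ∧ g a ≠ h a) ∧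
      ∀ a b, r a b ↔ b = f a ∨ b = g a ∨ b = h a := by
  obtain ⟨f, hf⟩ := exists_matching r 3 (by norm_num) ha hb rfl
  obtain ⟨ha1, hb1⟩ := remove_matching r 2 ha hb f hf
    (fun a b => r a b ∧ b ≠ f a) (fun _ _ => Iff.rfl)
  obtain ⟨g, hg⟩ := exists_matching (fun a b => r a b ∧ b ≠ f a) 2 (by norm_num) ha1 hb1 rfl
  obtain ⟨ha2, hb2⟩ := remove_matching (fun a b => r a b ∧ b ≠ f a) 1 ha1 hb1 g hg
    (fun a b => (r a b ∧ b ≠ f a) ∧ b ≠ g a) (fun _ _ => Iff.rfl)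
  obtain ⟨h, hh⟩ := exists_matching (fun a b => (r a b ∧ b ≠ f a) ∧ b ≠ g a) 1 (by norm_num) ha2 hb2 rfl
  refine ⟨f, g, h, ?_, ?_⟩
  · intro a
    exact ⟨(hg a).2.symm, (hh a).1.2.symm, (hh a).2.symm⟩
  · intro a b
    constructor
    · intro hr
      by_contra hn
      push Not at hn
      obtain ⟨c, hc⟩ := Finset.card_eq_one.1 (ha2 a)
      have h1 : b ∈ ({c} : Finset α) := by
        rw [← hc]; simp only [Finset.mem_filter, Finset.mem_univ, true_and]
        exact ⟨⟨hr, hn.1⟩, hn.2.1⟩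
      have h2 : h a ∈ ({c} : Finset α) := by
        rw [← hc]; simp only [Finset.mem_filter, Finset.mem_univ, true_and]
        exact hh a
      rw [Finset.mem_singleton] at h1 h2
      exact hn.2.2 (h1.trans h2.symm)
    · rintro (rfl | rfl | rfl)
      · exact hf a
      · exact (hg a).1
      · exact (hh a).1.1

/-- The simple graph underlying a multigraph. -/
def toSimple {V : Type} (H : Multigraph V) : SimpleGraph V where
  Adj a b := s(a, b) ∈ H.edges
  symm := ⟨fun a b h => by rw [Sym2.eq_swap]; exact h⟩
  loopless := ⟨fun a h => H.loopless _ h (by simp)⟩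

theorem supereulerian_of_tour {V : Type} [Fintype V] (H : Multigraph V)
    (h : HasTour H.toSimple) : H.Supereulerian := by
  obtain ⟨u, p, hp, hs⟩ := h
  have key : ∀ {a b : V} (q : H.toSimple.Walk a b), (∀ e ∈ q.edges, e ∈ p.edges) →
      Relation.ReflTransGen (fun a b => s(a, b) ∈ (p.edges : Multiset (Sym2 V))) a b := by
    intro a b q hq
    induction q with
    | nil => exact Relation.ReflTransGen.refl
    | cons hadj q ih =>
      refine Relation.ReflTransGen.head ?_ (ih fun e he => hq e (by simp [he]))
      exact Multiset.mem_coe.2 (hq _ (by simp))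
  refine ⟨(p.edges : Multiset (Sym2 V)), ?_, ⟨⟨u, trivial⟩, fun _ _ _ _ => trivial, ?_⟩, ?_⟩
  · rw [Multiset.le_iff_subset (by exact_mod_cast hp.edges_nodup)]
    intro e he
    have he' := p.edges_subset_edgeSet (Multiset.mem_coe.1 he)
    induction e with
    | _ a b => exact he'
  · intro a _ b _
    have h1 := key (p.takeUntil b (hs b)) (fun e he => p.edges_takeUntil_subset_edges _ he)
    have h2 := key (p.dropUntil a (hs a)) (fun e he => p.edges_dropUntil_subset_edges _ he)
    exact h2.trans h1
  · intro x
    have := (hp.even_countP_edges_iff x).2 (fun h => absurd rfl h)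
    rw [degIn, Multiset.filter_coe, Multiset.coe_card, ← List.countP_eq_length_filter]
    convert this

theorem nodup_of_reduced {V : Type} (H : Multigraph V) (hred : H.Reduced) : H.edges.Nodup := by
  rw [Multiset.nodup_iff_le]
  intro e he
  have hmem : e ∈ H.edges := Multiset.mem_of_le he (by simp)
  induction e with
  | _ a b =>
    have hab : a ≠ b := fun h => H.loopless _ hmem (by simp [h])
    have hw : ∀ E : Multiset (Sym2 V), (∀ e ∈ E, e = s(a, b)) → Within ({a, b} : Set V) E := by
      intro E hE e he v hv
      rw [hE e he] at hv
      simpa using hv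
    have hc : ∀ E : Multiset (Sym2 V), (∀ e ∈ E, e = s(a, b)) → s(a, b) ∈ E →
        ConnOn ({a, b} : Set V) E := by
      intro E hE hm
      refine ⟨⟨a, by simp⟩, hw E hE, ?_⟩
      rintro u (rfl | rfl) v (rfl | rfl)
      · exact Relation.ReflTransGen.refl
      · exact Relation.ReflTransGen.single hm
      · exact Relation.ReflTransGen.single (by rw [Sym2.eq_swap]; exact hm)
      · exact Relation.ReflTransGen.refl
    have h1 := hred {a, b} (s(a, b) ::ₘ s(a, b) ::ₘ 0) ⟨he, hw _ (by simp)⟩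
      ⟨⟨a, by simp⟩, hw _ (by simp), by
        intro R hR hRf hRe
        by_cases haR : a ∈ R <;> by_cases hbR : b ∈ R
        · refine ⟨{s(a, b)}, by simp, hc _ (by simp) (by simp), ?_⟩
          rintro x (rfl | rfl) <;> simp [degIn, Multiset.filter_singleton, haR, hbR]
        · exfalso
          have : R = {a} := by
            ext x; constructor
            · intro hx
              rcases hR hx with rfl | rfl
              · rfl
              · exact absurd hx hbR
            · rintro rfl; exact haR
          rw [this] at hRe; simp at hRe
        · exfalso
          have : R = {b} := by
            ext x; constructor
            · intro hx
              rcases hR hx with rfl | rfl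
              · exact absurd hx haR
              · rfl
            · rintro rfl; exact hbR
          rw [this] at hRe; simp at hRe
        · refine ⟨_, le_rfl, hc _ (by simp) (by simp), ?_⟩
          rintro x (rfl | rfl) <;>
            simp [degIn, Multiset.filter_cons_of_pos, Multiset.filter_singleton, haR, hbR]⟩
    rw [Set.ncard_pair hab] at h1
    omega

theorem deg_eq {V : Type} [Fintype V] (H : Multigraph V) (hn : H.edges.Nodup) (v : V) :
    H.deg v = (Finset.univ.filter fun w => s(v, w) ∈ H.edges).card := by
  have : H.edges.filter (fun e => v ∈ e) =
      ((Finset.univ.filter fun w => s(v, w) ∈ H.edges).map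
        ⟨fun w => s(v, w), fun a b h => Sym2.congr_right.1 h⟩).val := by
    rw [Multiset.Nodup.ext (hn.filter _) (Finset.nodup _)]
    intro e
    simp only [Multiset.mem_filter, Finset.mem_val, Finset.mem_map, Finset.mem_filter,
      Finset.mem_univ, true_and]
    constructor
    · rintro ⟨h1, w, rfl⟩
      exact ⟨w, h1, rfl⟩
    · rintro ⟨w, h1, rfl⟩
      exact ⟨h1, Sym2.mem_mk_left _ _⟩
  rw [deg, degIn, this]
  exact Finset.card_map _

end Multigraph

open Multigraph HamSearch

/-- Theorem 3.3(a). Let `H` be a connected reduced bipartite graph with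
bipartition `{X, Y}` where `|X| ≤ 7`, `|Y| ≥ |X|` and `d_H(v) ≥ 3` for every `v ∈ Y`.
Then either `H` has a 4-cycle passing through a vertex of `X` of degree at least 4,
or `|Y| = |X|` and `H` is supereulerian. -/
theorem statement4 {V : Type} [Fintype V] (H : Multigraph V)
    (hconn : H.Connected) (hred : H.Reduced)
    (X Y : Finset V) (hbip : Multigraph.IsBipartition X Y H.edges)
    (hX7 : X.card ≤ 7) (hXY : X.card ≤ Y.card)
    (hdeg : ∀ y ∈ Y, 3 ≤ H.deg y) :
    (∃ a ∈ X, 4 ≤ H.deg a ∧ ∃ b c d : V,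
        a ≠ b ∧ a ≠ c ∧ a ≠ d ∧ b ≠ c ∧ b ≠ d ∧ c ≠ d ∧
        s(a, b) ∈ H.edges ∧ s(b, c) ∈ H.edges ∧ s(c, d) ∈ H.edges ∧ s(d, a) ∈ H.edges) ∨
      (Y.card = X.card ∧ H.Supereulerian) := by
  have hnd := H.nodup_of_reduced hred
  obtain ⟨hdisj, huniv, hedge⟩ := hbip
  have hXY' : ∀ v, v ∈ X ∨ v ∈ Y := by
    intro v
    rw [← Finset.mem_union, huniv]; exact Finset.mem_univ v
  have hnot : ∀ v, v ∈ X → v ∉ Y := fun v h1 h2 => Finset.disjoint_left.1 hdisj h1 h2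
  have hXtoY : ∀ a b, s(a, b) ∈ H.edges → a ∈ X → b ∈ Y := by
    intro a b h ha
    obtain ⟨-, c, hc, hcY⟩ := hedge _ h
    rcases Sym2.mem_iff.1 hc with rfl | rfl
    · exact absurd hcY (hnot _ ha)
    · exact hcY
  have hYtoX : ∀ a b, s(a, b) ∈ H.edges → a ∈ Y → b ∈ X := by
    intro a b h ha
    obtain ⟨⟨c, hc, hcX⟩, -⟩ := hedge _ h
    rcases Sym2.mem_iff.1 hc with rfl | rfl
    · exact absurd ha (hnot _ hcX)
    · exact hcX
  have hdegY : ∀ y, H.deg y = (Finset.univ.filter fun w => s(y, w) ∈ H.edges).card :=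
    H.deg_eq hnd
  by_contra hcon
  rw [not_or] at hcon
  obtain ⟨hno, hcon⟩ := hcon
  apply hcon
  have hirr : ∀ a b, s(a, b) ∈ H.edges → a ≠ b := by
    rintro a b h rfl
    exact H.loopless _ h (by simp)
  have hdegX : ∀ x ∈ X, H.deg x ≤ 3 := by
    intro a ha
    by_contra hlt
    push Not at hlt
    have hlt' : 4 ≤ H.deg a := hlt
    have hcard : ∀ b ∈ Finset.univ.filter (fun w => s(a, w) ∈ H.edges),
        2 ≤ ((Finset.univ.filter fun w => s(b, w) ∈ H.edges).erase a).card := by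
      intro b hb
      simp only [Finset.mem_filter, Finset.mem_univ, true_and] at hb
      have h3 := hdeg b (hXtoY _ _ hb ha)
      rw [hdegY] at h3
      have := Finset.pred_card_le_card_erase
        (s := Finset.univ.filter fun w => s(b, w) ∈ H.edges) (a := a)
      omega
    have hsub : (Finset.univ.filter (fun w => s(a, w) ∈ H.edges)).biUnion
        (fun b => (Finset.univ.filter fun w => s(b, w) ∈ H.edges).erase a) ⊆ X.erase a := by
      intro c hc
      simp only [Finset.mem_biUnion, Finset.mem_filter, Finset.mem_univ, true_and,
        Finset.mem_erase] at hc ⊢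
      obtain ⟨b, hb, hca, hbc⟩ := hc
      exact ⟨hca, hYtoX _ _ hbc (hXtoY _ _ hb ha)⟩
    have h1 := Finset.card_le_card hsub
    have hpd : ∀ b ∈ Finset.univ.filter (fun w => s(a, w) ∈ H.edges),
        ∀ d ∈ Finset.univ.filter (fun w => s(a, w) ∈ H.edges), b ≠ d →
        Disjoint ((Finset.univ.filter fun w => s(b, w) ∈ H.edges).erase a)
          ((Finset.univ.filter fun w => s(d, w) ∈ H.edges).erase a) := by
      intro b hb d hd hbd
      simp only [Finset.mem_filter, Finset.mem_univ, true_and] at hb hd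
      rw [Finset.disjoint_left]
      intro c hc1 hc2
      simp only [Finset.mem_filter, Finset.mem_univ, true_and, Finset.mem_erase] at hc1 hc2
      refine hno ⟨a, ha, hlt', b, c, d, hirr _ _ hb, hc1.1.symm, hirr _ _ hd, hirr _ _ hc1.2,
        hbd, (hirr _ _ hc2.2).symm, hb, hc1.2, ?_, ?_⟩
      · rw [Sym2.eq_swap]; exact hc2.2
      · rw [Sym2.eq_swap]; exact hd
    rw [Finset.card_erase_of_mem ha, Finset.card_biUnion hpd] at h1
    have h2 := Finset.card_nsmul_le_sum _ _ _ hcard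
    rw [← hdegY, smul_eq_mul] at h2
    omega
  -- double counting
  have hAbove : ∀ x ∈ X, (Y.bipartiteAbove (fun x y => s(x, y) ∈ H.edges) x).card = H.deg x := by
    intro x hx
    rw [hdegY]
    congr 1
    ext y
    simp only [Finset.mem_bipartiteAbove, Finset.mem_filter, Finset.mem_univ, true_and]
    exact ⟨fun h => h.2, fun h => ⟨hXtoY _ _ h hx, h⟩⟩
  have hBelow : ∀ y ∈ Y, (X.bipartiteBelow (fun x y => s(x, y) ∈ H.edges) y).card = H.deg y := by
    intro y hy
    rw [hdegY]
    congr 1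
    ext x
    simp only [Finset.mem_bipartiteBelow, Finset.mem_filter, Finset.mem_univ, true_and]
    rw [Sym2.eq_swap]
    exact ⟨fun h => h.2, fun h => ⟨hYtoX _ _ h hy, h⟩⟩
  have hsum : ∑ x ∈ X, H.deg x = ∑ y ∈ Y, H.deg y := by
    rw [← Finset.sum_congr rfl hAbove, ← Finset.sum_congr rfl hBelow]
    exact Finset.sum_card_bipartiteAbove_eq_sum_card_bipartiteBelow _
  have hs1 : ∑ x ∈ X, H.deg x ≤ ∑ x ∈ X, 3 := Finset.sum_le_sum hdegX
  have hs2 : ∑ y ∈ Y, 3 ≤ ∑ y ∈ Y, H.deg y := Finset.sum_le_sum hdeg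
  have hc1 : ∑ x ∈ X, 3 = X.card * 3 := by simp
  have hc2 : ∑ y ∈ Y, 3 = Y.card * 3 := by simp
  have hcard : Y.card = X.card := by omega
  have hX3 : ∀ x ∈ X, H.deg x = 3 :=
    (Finset.sum_eq_sum_iff_of_le hdegX).1 (by omega)
  have hY3 : ∀ y ∈ Y, 3 = H.deg y :=
    (Finset.sum_eq_sum_iff_of_le hdeg).1 (by omega)
  refine ⟨hcard, H.supereulerian_of_tour ?_⟩
  -- labelling
  obtain ⟨n, hn⟩ : ∃ n, X.card = n := ⟨_, rfl⟩
  let ex : Fin n ≃ X := (X.equivFinOfCardEq hn).symm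
  let ey : Fin n ≃ Y := (Y.equivFinOfCardEq (hcard.trans hn)).symm
  obtain ⟨f, g, h, hne, hr⟩ := three_factors (fun i j : Fin n => s((ex i : V), (ey j : V)) ∈ H.edges)
    (by
      intro i
      rw [← hX3 (ex i) (ex i).2, hdegY]
      refine Finset.card_bij (fun j _ => (ey j : V)) ?_ ?_ ?_
      · intro j hj
        simpa using hj
      · intro j _ k _ hjk
        exact ey.injective (Subtype.ext hjk)
      · intro w hw
        simp only [Finset.mem_filter, Finset.mem_univ, true_and] at hw
        have hwY := hXtoY _ _ hw (ex i).2
        exact ⟨ey.symm ⟨w, hwY⟩, by simpa using hw, by simp⟩)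
    (by
      intro j
      rw [hY3 (ey j) (ey j).2, hdegY]
      refine Finset.card_bij (fun i _ => (ex i : V)) ?_ ?_ ?_
      · intro i hi
        simp only [Finset.mem_filter, Finset.mem_univ, true_and] at hi ⊢
        rw [Sym2.eq_swap]; exact hi
      · intro j _ k _ hjk
        exact ex.injective (Subtype.ext hjk)
      · intro w hw
        simp only [Finset.mem_filter, Finset.mem_univ, true_and] at hw
        have hwX := hYtoX _ _ hw (ey j).2
        rw [Sym2.eq_swap] at hw
        exact ⟨ex.symm ⟨w, hwX⟩, by simpa using hw, by simp⟩)
  have hr' : ∀ i j, s((ex i : V), (ey j : V)) ∈ H.edges ↔ j = f i ∨ j = g i ∨ j = h i := hr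
  let xs : Fin n → V := fun i => ex i
  let ys : Fin n → V := fun j => ey (f j)
  have hcl : ∀ (π : Equiv.Perm (Fin n)) (S : Set (Fin n)), (∀ i ∈ S, π i ∈ S) →
      ∀ i, π i ∈ S → i ∈ S := by
    intro π S hS i hi
    have himg : S.toFinset.image π = S.toFinset := by
      apply Finset.eq_of_subset_of_card_le
      · intro j hj
        simp only [Finset.mem_image, Set.mem_toFinset] at hj ⊢
        obtain ⟨k, hk, rfl⟩ := hj
        exact hS k hk
      · rw [Finset.card_image_of_injective _ π.injective]
    have hmem : π i ∈ S.toFinset.image π := by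
      rw [himg, Set.mem_toFinset]; exact hi
    simp only [Finset.mem_image, Set.mem_toFinset] at hmem
    obtain ⟨k, hk, e⟩ := hmem
    rw [← π.injective e]; exact hk
  have M : Model H.toSimple xs ys (g.trans f.symm) (h.trans f.symm) := by
    refine ⟨⟨?_, ?_⟩, ?_, ?_, ?_, ?_, ?_⟩
    · rintro (i | i) (j | j) hij
      · exact congrArg Sum.inl (ex.injective (Subtype.ext hij))
      · have hij' : (ex i : V) = ey (f j) := hij
        exact absurd (ey (f j)).2 (hnot _ (hij' ▸ (ex i).2))
      · have hij' : (ey (f i) : V) = ex j := hij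
        exact absurd (ey (f i)).2 (hnot _ (hij' ▸ (ex j).2))
      · exact congrArg Sum.inr (f.injective (ey.injective (Subtype.ext hij)))
    · intro v
      rcases hXY' v with hv | hv
      · exact ⟨Sum.inl (ex.symm ⟨v, hv⟩), by simp [xs]⟩
      · exact ⟨Sum.inr (f.symm (ey.symm ⟨v, hv⟩)), by simp [ys]⟩
    · intro i j hj
      refine (hr' i (f j)).2 ?_
      rcases hj with rfl | rfl | rfl <;> simp
    · intro S hS hSc i
      obtain ⟨i₀, hi₀⟩ := hS
      have hconn' := hconn.2.2 (xs i₀) trivial (xs i) trivial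
      have hT : ∀ v, Relation.ReflTransGen (fun a b => s(a, b) ∈ H.edges) (xs i₀) v →
          ∃ k ∈ S, v = xs k ∨ v = ys k := by
        intro v hv
        induction hv with
        | refl => exact ⟨i₀, hi₀, Or.inl rfl⟩
        | @tail b c _ hbc ih =>
          obtain ⟨k, hk, rfl | rfl⟩ := ih
          · have hcY := hXtoY _ _ hbc (ex k).2
            obtain ⟨j, hj⟩ : ∃ j, c = ey j := ⟨ey.symm ⟨c, hcY⟩, by simp⟩
            rw [hj] at hbc
            rcases (hr' k j).1 hbc with e | e | e
            · exact ⟨k, hk, Or.inr (by rw [hj, e])⟩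
            · exact ⟨_, (hSc k hk).1, Or.inr (by rw [hj, e]; simp [ys])⟩
            · exact ⟨_, (hSc k hk).2, Or.inr (by rw [hj, e]; simp [ys])⟩
          · have hcX := hYtoX _ _ hbc (ey (f k)).2
            obtain ⟨j, hj⟩ : ∃ j, c = ex j := ⟨ex.symm ⟨c, hcX⟩, by simp⟩
            rw [hj, Sym2.eq_swap] at hbc
            refine ⟨j, ?_, Or.inl hj⟩
            rcases (hr' j (f k)).1 hbc with e | e | e
            · rw [f.injective e] at hk; exact hk
            · apply hcl (g.trans f.symm) S (fun i hi => (hSc i hi).1)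
              simpa [← e] using hk
            · apply hcl (h.trans f.symm) S (fun i hi => (hSc i hi).2)
              simpa [← e] using hk
      obtain ⟨k, hk, e | e⟩ := hT _ hconn'
      · have := ex.injective (Subtype.ext e)
        rw [this]; exact hk
      · have e' : (ex i : V) = ey (f k) := e
        exact absurd (ey (f k)).2 (hnot _ (e' ▸ (ex i).2))
    · intro i hi
      have : g i = f i := by simpa [Equiv.symm_apply_eq] using hi
      exact (hne i).1 this.symm
    · intro i hi
      have : h i = f i := by simpa [Equiv.symm_apply_eq] using hi
      exact (hne i).2.1 this.symm
    · intro i hi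
      have : h i = g i := by simpa using hi
      exact (hne i).2.2 this.symm
  have hn2 : 2 ≤ n := by
    obtain ⟨v, -⟩ := hconn.1
    have hXne : 0 < n := by
      rcases hXY' v with hv | hv
      · rw [← hn]; exact Finset.card_pos.2 ⟨v, hv⟩
      · rw [← hn, ← hcard]; exact Finset.card_pos.2 ⟨v, hv⟩
    by_contra hlt
    have hn1 : n = 1 := by omega
    subst hn1
    exact (hne 0).1 (Subsingleton.elim _ _)
  exact tour M hn2 (hn ▸ hX7)
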